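/- Let L be a C^k (k ≥ 2) Tonelli Lagrangian on T𝕋ⁿ without conjugate points, with Euler–Lagrange flow (φ_t). Then for every t > 0 and every x ∈ ℝⁿ, the map F : ℝⁿ → ℝⁿ sending v to the first component of φ_t(x, v) is injective. -/

import Mathlib

open MeasureTheory
open scoped NNReal

noncomputable section

abbrev E (n : ℕ) : Type := Fin n → ℝ

/-- The vector of `ℝⁿ` whose coordinates are the integers `m i`. -/
def intVec {n : ℕ} (m : Fin n → ℤ) : E n := fun i => (m i : ℝ)

/-- A Tonelli Lagrangian on `T𝕋ⁿ`, identified with a `ℤⁿ`-periodic (in `x`) function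
on `ℝⁿ × ℝⁿ` which is `Cᵏ`, uniformly superlinear in `v` and with positive definite
fiberwise Hessian. -/
structure IsTonelliLagrangian (n : ℕ) (k : ℕ∞) (L : E n × E n → ℝ) : Prop where
  smooth : ContDiff ℝ k L
  periodic : ∀ (x v : E n) (m : Fin n → ℤ), L (x + intVec m, v) = L (x, v)
  superlinear : ∀ C : ℝ, ∃ R : ℝ, ∀ (x v : E n), R ≤ ‖v‖ → C * ‖v‖ ≤ L (x, v)
  posdef : ∀ (x v w : E n), w ≠ 0 →
    0 < fderiv ℝ (fun v' => fderiv ℝ (fun v'' => L (x, v'')) v' w) v w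

/-- Partial differential of `L` in the fiber (velocity) direction. -/
def partialV (n : ℕ) (L : E n × E n → ℝ) (x v : E n) : E n →L[ℝ] ℝ :=
  fderiv ℝ (fun v' => L (x, v')) v

/-- Partial differential of `L` in the base (position) direction. -/
def partialX (n : ℕ) (L : E n × E n → ℝ) (x v : E n) : E n →L[ℝ] ℝ :=
  fderiv ℝ (fun x' => L (x', v)) x

/-- A `C²` curve satisfying the Euler–Lagrange equation
`d/dt (∂L/∂v(γ, γ')) = ∂L/∂x(γ, γ')`. -/
def IsExtremal (n : ℕ) (L : E n × E n → ℝ) (γ : ℝ → E n) : Prop :=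
  ContDiff ℝ 2 γ ∧
  ∀ t : ℝ, HasDerivAt (fun s => partialV n L (γ s) (deriv γ s))
    (partialX n L (γ t) (deriv γ t)) t

/-- `φ` is the (complete, `C^{k-1}`) Euler–Lagrange flow of `L` on `ℝⁿ × ℝⁿ`:
`φ t (x,v) = (γ t, γ' t)` where `γ` is the extremal curve with `(γ 0, γ' 0) = (x, v)`. -/
def IsELFlow (n : ℕ) (k : ℕ) (L : E n × E n → ℝ)
    (φ : ℝ → E n × E n → E n × E n) : Prop :=
  ContDiff ℝ ((k - 1 : ℕ) : ℕ∞) (fun p : ℝ × (E n × E n) => φ p.1 p.2) ∧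
  (∀ z : E n × E n, φ 0 z = z) ∧
  ∀ x v : E n, IsExtremal n L (fun t => (φ t (x, v)).1) ∧
    ∀ t : ℝ, (φ t (x, v)).2 = deriv (fun s => (φ s (x, v)).1) t

/-- The flow `φ` has no conjugate points: for `t ≠ 0` the image of the vertical
subspace `{0} × ℝⁿ` under `Dφ_t(z)` meets `{0} × ℝⁿ` only in `0`. -/
def NoConjugatePoints (n : ℕ) (φ : ℝ → E n × E n → E n × E n) : Prop :=
  ∀ (z : E n × E n) (t : ℝ), t ≠ 0 → ∀ w : E n,
    (fderiv ℝ (φ t) z (0, w)).1 = 0 → w = 0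

/-- The absolutely continuous curve starting at `x` with derivative `g`. -/
def curveOf (n : ℕ) (x : E n) (g : ℝ → E n) : ℝ → E n :=
  fun s => x + ∫ u in (0:ℝ)..s, g u

/-- `Acost n L t x y` = the infimum of the Lagrangian action over all absolutely
continuous curves `c : [0,t] → ℝⁿ` with `c 0 = x` and `c t = y`. -/
def Acost (n : ℕ) (L : E n × E n → ℝ) (t : ℝ) (x y : E n) : ℝ :=
  sInf { A : ℝ | ∃ g : ℝ → E n,
    IntervalIntegrable g volume 0 t ∧
    curveOf n x g t = y ∧
    IntervalIntegrable (fun s => L (curveOf n x g s, g s)) volume 0 t ∧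
    A = ∫ s in (0:ℝ)..t, L (curveOf n x g s, g s) }

section GlobalInversion

open Set Filter Topology

variable {V W : Type*} [NormedAddCommGroup V] [NormedAddCommGroup W] [NormedSpace ℝ W]

/-- The rescaled primitive `(s, v) ↦ ∫₀¹ h (s r, v) dr = s⁻¹ ∫₀ˢ h (q, v) dq`,
which is regular across `s = 0`. -/
def timeAverage (h : ℝ × V → W) (p : ℝ × V) : W := ∫ r in (0 : ℝ)..1, h (p.1 * r, p.2)

lemma smul_integral_unit_eq (g : ℝ → W) (s : ℝ) :
    s • (∫ r in (0 : ℝ)..1, g (s * r)) = ∫ q in (0 : ℝ)..s, g q := by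
  simp

lemma hasDerivAt_smul_integral_unit [CompleteSpace W] {g : ℝ → W} (hg : Continuous g) (s : ℝ) :
    HasDerivAt (fun s => s • ∫ r in (0 : ℝ)..1, g (s * r)) (g s) s := by
  simp_rw [smul_integral_unit_eq]
  exact hg.integral_hasStrictDerivAt 0 s |>.hasDerivAt

lemma hasDerivAt_smul_timeAverage [CompleteSpace W] {h : ℝ × V → W} (hh : Continuous h)
    (s : ℝ) (v : V) : HasDerivAt (fun s => s • timeAverage h (s, v)) (h (s, v)) s :=
  hasDerivAt_smul_integral_unit (g := fun q => h (q, v)) (by fun_prop) s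

/-- A constant path `w` lifts through the maps `G (s, ·)`, `0 ≤ s ≤ T`, as soon as all its partial
lifts are a priori bounded. -/
lemma exists_lift_of_bounded [ProperSpace V] {G : ℝ × V → V} (hG : Continuous G)
    (hloc : IsLocalHomeomorph fun p : ℝ × V => (p.1, G p)) {w z₀ : V} (h₀ : G (0, z₀) = w)
    {T R : ℝ} (hT : 0 ≤ T)
    (hR : ∀ τ ∈ Icc 0 T, ∀ z : ℝ → V, ContinuousOn z (Icc 0 τ) → z 0 = z₀ →
      (∀ s ∈ Icc 0 τ, G (s, z s) = w) → ‖z τ‖ ≤ R) :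
    ∃ z : ℝ → V, ContinuousOn z (Icc 0 T) ∧ z 0 = z₀ ∧ ∀ s ∈ Icc 0 T, G (s, z s) = w := by
  set A : Set ℝ := {τ | τ ∈ Icc 0 T ∧ ∃ z : ℝ → V, ContinuousOn z (Icc 0 τ) ∧ z 0 = z₀ ∧
    ∀ s ∈ Icc 0 τ, G (s, z s) = w}
  have hA0 : (0 : ℝ) ∈ A := by
    refine ⟨⟨le_rfl, hT⟩, fun _ => z₀, continuousOn_const, rfl, fun s hs => ?_⟩
    rw [le_antisymm hs.2 hs.1, h₀]
  have hbdd : BddAbove A := ⟨T, fun τ hτ => hτ.1.2⟩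
  have hsupT : sSup A ≤ T := csSup_le ⟨0, hA0⟩ fun τ hτ => hτ.1.2
  obtain ⟨t, -, htlim, htA⟩ := exists_seq_tendsto_sSup ⟨0, hA0⟩ hbdd
  choose htT z hzc hz0 hzG using htA
  obtain ⟨b, -, ψ, hψ, hb⟩ := (isCompact_closedBall (0 : V) R).tendsto_subseq
    (x := fun m => z m (t m)) fun m => by
      rw [mem_closedBall_zero_iff]
      exact hR _ (htT m) _ (hzc m) (hz0 m) (hzG m)
  have hlim : Tendsto (fun m => (t (ψ m), z (ψ m) (t (ψ m)))) atTop (𝓝 (sSup A, b)) :=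
    (htlim.comp hψ.tendsto_atTop).prodMk_nhds hb
  have hGb : G (sSup A, b) = w := by
    refine tendsto_nhds_unique ((hG.tendsto _).comp hlim) ?_
    refine tendsto_const_nhds.congr fun m => ?_
    exact (hzG (ψ m) (t (ψ m)) ⟨(htT _).1, le_rfl⟩).symm
  obtain ⟨e, hbe, he⟩ := hloc (sSup A, b)
  have hbt : (sSup A, w) ∈ e.target := by
    have := e.map_source hbe
    rw [← he] at this
    simpa [hGb] using this
  have htarget : ∀ᶠ s in 𝓝 (sSup A), (s, w) ∈ e.target :=
    (Continuous.prodMk_left w).continuousAt.preimage_mem_nhds (e.open_target.mem_nhds hbt)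
  obtain ⟨δ, hδ, hball⟩ := Metric.eventually_nhds_iff.1 htarget
  have hev : ∀ᶠ m in atTop, dist (t (ψ m)) (sSup A) < δ ∧ (t (ψ m), z (ψ m) (t (ψ m))) ∈ e.source :=
    ((htlim.comp hψ.tendsto_atTop).eventually (Metric.ball_mem_nhds _ hδ)).and
      (hlim.eventually (e.open_source.mem_nhds hbe))
  obtain ⟨m, hm1, hm2⟩ := hev.exists
  set τ := t (ψ m)
  set y := z (ψ m)
  have hτA : τ ≤ sSup A := le_csSup hbdd ⟨htT _, y, hzc _, hz0 _, hzG _⟩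
  have hτ0 : 0 ≤ τ := (htT _).1
  rw [Real.dist_eq, abs_lt] at hm1
  have hinv : ∀ s, (s, w) ∈ e.target →
      (e.symm (s, w)).1 = s ∧ G (s, (e.symm (s, w)).2) = w := by
    intro s hs
    have h1 := e.right_inv hs
    rw [← he] at h1
    have h2 : (e.symm (s, w)).1 = s := congrArg Prod.fst h1
    refine ⟨h2, ?_⟩
    have h3 : G (e.symm (s, w)) = w := congrArg Prod.snd h1
    have h4 : (s, (e.symm (s, w)).2) = e.symm (s, w) := Prod.ext h2.symm rfl
    rw [h4, h3]
  have hmatch : (e.symm (τ, w)).2 = y τ := by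
    have h1 := e.left_inv hm2
    rw [← he] at h1
    have h2 : G (τ, y τ) = w := hzG _ _ ⟨hτ0, le_rfl⟩
    simp only [h2] at h1
    rw [h1]
  set τ' := min T (sSup A + δ / 2)
  have hττ' : τ ≤ τ' := le_min (hτA.trans hsupT) (by linarith)
  have htg : ∀ s ∈ Icc τ τ', (s, w) ∈ e.target := fun s hs => by
    refine hball ?_
    have := hs.2.trans (min_le_right _ _)
    have := hs.1
    rw [Real.dist_eq, abs_lt]
    constructor <;> linarith
  have hmem : τ' ∈ A := by
    refine ⟨⟨hτ0.trans hττ', min_le_left _ _⟩,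
      fun s => if s ≤ τ then y s else (e.symm (s, w)).2, ?_, ?_, ?_⟩
    · rw [← Icc_union_Icc_eq_Icc hτ0 hττ']
      refine ContinuousOn.union_of_isClosed ?_ ?_ isClosed_Icc isClosed_Icc
      · exact (hzc (ψ m)).congr fun s hs => if_pos hs.2
      · have : ContinuousOn (fun s => (e.symm (s, w)).2) (Icc τ τ') :=
          continuous_snd.comp_continuousOn
            (e.continuousOn_symm.comp (Continuous.prodMk_left w).continuousOn htg)
        refine this.congr fun s hs => ?_
        rcases hs.1.eq_or_lt with h | h
        · rw [← h]; simp [hmatch]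
        · exact if_neg h.not_ge
    · simp [hτ0, y, hz0]
    · intro s hs
      by_cases h : s ≤ τ
      · simpa [h] using hzG _ s ⟨hs.1, h⟩
      · simpa [h] using (hinv s (htg s ⟨(not_le.1 h).le, hs.2⟩)).2
  have hle : τ' ≤ sSup A := le_csSup hbdd hmem
  have hτ'T : τ' = T := by
    rcases min_choice T (sSup A + δ / 2) with h | h
    · exact h
    · have : τ' = sSup A + δ / 2 := h
      linarith
  rw [hτ'T] at hmem
  exact hmem.2

/-- If constant paths lift through a continuous family of maps starting at the identity, with a
local homeomorphism as total map, then all the maps of the family are injective. -/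
lemma injective_of_exists_lift {G : ℝ × V → V} (hG : Continuous G)
    (hloc : IsLocalHomeomorph fun p : ℝ × V => (p.1, G p)) (hid : ∀ v, G (0, v) = v)
    {T : ℝ} (hT : 0 ≤ T)
    (hlift : ∀ w : V, ∃ z : ℝ → V, ContinuousOn z (Icc 0 T) ∧ z 0 = w ∧
      ∀ s ∈ Icc 0 T, G (s, z s) = w) :
    Function.Injective fun v => G (T, v) := by
  choose z hzc hz0 hzG using hlift
  have hsep : IsSeparatedMap fun p : ℝ × V => (p.1, G p) := T2Space.isSeparatedMap _
  have hmem : ∀ r : unitInterval, (r : ℝ) * T ∈ Icc 0 T := fun r =>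
    ⟨mul_nonneg r.2.1 hT, mul_le_of_le_one_left hT r.2.2⟩
  have hσ : Continuous fun q : unitInterval × V => ((q.1 : ℝ) * T, z q.2 (q.1 * T)) := by
    refine hloc.continuous_lift hsep ⟨fun q : unitInterval × V => ((q.1 : ℝ) * T, q.2), by fun_prop⟩
      ?_ ?_ ?_
    · funext q
      simp [hzG q.2 _ (hmem q.1)]
    · simpa [hz0] using Continuous.prodMk_right (0 : ℝ)
    · intro w
      refine Continuous.prodMk (by fun_prop) ?_
      exact (hzc w).comp_continuous (by fun_prop) hmem
  have key : ∀ v, z (G (T, v)) T = v := by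
    intro v
    have h := hsep.eq_of_comp_eq hloc.isLocallyInjective (A := unitInterval)
      (g₁ := fun r => ((r : ℝ) * T, z (G (r * T, v)) (r * T)))
      (g₂ := fun r => ((r : ℝ) * T, v))
      (hσ.comp (by fun_prop : Continuous fun r : unitInterval => (r, G ((r : ℝ) * T, v))))
      (by fun_prop) (by funext r; simp [hzG _ _ (hmem r)]) 0 (by simp [hid, hz0])
    simpa using congrArg Prod.snd (congrFun h 1)
  exact Function.LeftInverse.injective (g := fun w => z w T) key

variable [NormedSpace ℝ V]

/-- The derivative of the integrand of `timeAverage`. -/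
def timeAverageDeriv (h : ℝ × V → W) (p : ℝ × V) (r : ℝ) : ℝ × V →L[ℝ] W :=
  (fderiv ℝ h (p.1 * r, p.2)).comp
    ((r • ContinuousLinearMap.fst ℝ ℝ V).prod (ContinuousLinearMap.snd ℝ ℝ V))

lemma continuous_timeAverageDeriv {h : ℝ × V → W} (hh : ContDiff ℝ 1 h) :
    Continuous (fun q : (ℝ × V) × ℝ => timeAverageDeriv h q.1 q.2) := by
  have h1 : Continuous (fderiv ℝ h) := hh.continuous_fderiv one_ne_zero
  have h2 : Continuous (fun q : (ℝ × V) × ℝ =>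
      (q.2 • ContinuousLinearMap.fst ℝ ℝ V).prod (ContinuousLinearMap.snd ℝ ℝ V)) := by
    have h3 : (fun q : (ℝ × V) × ℝ =>
        (q.2 • ContinuousLinearMap.fst ℝ ℝ V).prod (ContinuousLinearMap.snd ℝ ℝ V)) =
        fun q => q.2 • (ContinuousLinearMap.fst ℝ ℝ V).prod (0 : ℝ × V →L[ℝ] V) +
          (0 : ℝ × V →L[ℝ] ℝ).prod (ContinuousLinearMap.snd ℝ ℝ V) := by
      funext q
      ext <;> simp
    rw [h3]
    fun_prop
  exact (h1.comp (by fun_prop : Continuous fun q : (ℝ × V) × ℝ => (q.1.1 * q.2, q.1.2))).clm_comp h2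

lemma hasFDerivAt_timeAverage [ProperSpace V] {h : ℝ × V → W} (hh : ContDiff ℝ 1 h) (p : ℝ × V) :
    HasFDerivAt (timeAverage h) (∫ r in (0 : ℝ)..1, timeAverageDeriv h p r) p := by
  have hc := continuous_timeAverageDeriv hh
  have hcont : Continuous h := hh.continuous
  obtain ⟨C, hC⟩ := ((isCompact_closedBall p 1).prod
    (isCompact_Icc (a := (0 : ℝ)) (b := 1))).exists_bound_of_continuousOn hc.continuousOn
  refine intervalIntegral.hasFDerivAt_integral_of_dominated_of_fderiv_le
    (F := fun (p : ℝ × V) r => h (p.1 * r, p.2)) (bound := fun _ => C)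
    (Metric.closedBall_mem_nhds p one_pos) ?_ ?_ ?_ ?_ ?_ ?_
  · refine Eventually.of_forall fun q => Continuous.aestronglyMeasurable ?_
    fun_prop
  · refine Continuous.intervalIntegrable ?_ _ _
    fun_prop
  · exact (hc.comp (Continuous.prodMk_right p)).aestronglyMeasurable
  · refine Eventually.of_forall fun r hr q hq => hC (q, r) ⟨hq, ?_⟩
    rw [uIoc_of_le zero_le_one] at hr
    exact ⟨hr.1.le, hr.2⟩
  · exact intervalIntegrable_const
  · refine Eventually.of_forall fun r _ q _ => ?_
    have h1 : HasFDerivAt h (fderiv ℝ h (q.1 * r, q.2)) (q.1 * r, q.2) :=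
      (hh.differentiable one_ne_zero _).hasFDerivAt
    have h2 : HasFDerivAt (fun q : ℝ × V => (q.1 * r, q.2))
        ((r • ContinuousLinearMap.fst ℝ ℝ V).prod (ContinuousLinearMap.snd ℝ ℝ V)) q :=
      (hasFDerivAt_fst.mul_const r).prodMk hasFDerivAt_snd
    exact h1.comp q h2

lemma contDiff_timeAverage [ProperSpace V] {h : ℝ × V → W} (hh : ContDiff ℝ 1 h) :
    ContDiff ℝ 1 (timeAverage h) :=
  contDiff_one_iff_hasFDerivAt.2 ⟨_,
    intervalIntegral.continuous_parametric_intervalIntegral_of_continuous'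
      (f := timeAverageDeriv h) (continuous_timeAverageDeriv hh) 0 1, hasFDerivAt_timeAverage hh⟩

lemma fderiv_timeAverage_inr [ProperSpace V] {h : ℝ × V → W} (hh : ContDiff ℝ 1 h)
    (p : ℝ × V) (u : V) :
    fderiv ℝ (timeAverage h) p (0, u) = ∫ r in (0 : ℝ)..1, fderiv ℝ h (p.1 * r, p.2) (0, u) := by
  rw [(hasFDerivAt_timeAverage hh p).fderiv, ContinuousLinearMap.intervalIntegral_apply]
  · simp [timeAverageDeriv]
  · exact ((continuous_timeAverageDeriv hh).comp (Continuous.prodMk_right p)).intervalIntegrable _ _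

lemma hasDerivAt_smul_fderiv_timeAverage [ProperSpace V] [CompleteSpace W] {h : ℝ × V → W}
    (hh : ContDiff ℝ 1 h) (s : ℝ) (v u : V) :
    HasDerivAt (fun s => s • fderiv ℝ (timeAverage h) (s, v) (0, u))
      (fderiv ℝ h (s, v) (0, u)) s := by
  simp_rw [fderiv_timeAverage_inr hh]
  have h1 : Continuous (fderiv ℝ h) := hh.continuous_fderiv one_ne_zero
  exact hasDerivAt_smul_integral_unit (g := fun q => fderiv ℝ h (q, v) (0, u)) (by fun_prop) s

lemma fderiv_smul_timeAverage [ProperSpace V] [CompleteSpace W] {h : ℝ × V → W}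
    (hh : ContDiff ℝ 1 h) (s : ℝ) (v : V) (a : ℝ) (u : V) :
    fderiv ℝ (fun p : ℝ × V => p.1 • timeAverage h p) (s, v) (a, u) =
      a • h (s, v) + s • fderiv ℝ (timeAverage h) (s, v) (0, u) := by
  have hA : Differentiable ℝ (timeAverage h) := (contDiff_timeAverage hh).differentiable one_ne_zero
  have hd : DifferentiableAt ℝ (fun p : ℝ × V => p.1 • timeAverage h p) (s, v) := by fun_prop
  have h1 : fderiv ℝ (fun p : ℝ × V => p.1 • timeAverage h p) (s, v) (1, 0) = h (s, v) := by
    have := hd.hasFDerivAt.comp_hasDerivAt s ((hasDerivAt_id s).prodMk (hasDerivAt_const s v))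
    exact this.unique (hasDerivAt_smul_timeAverage hh.continuous s v)
  have h2 : fderiv ℝ (fun p : ℝ × V => p.1 • timeAverage h p) (s, v) (0, u) =
      s • fderiv ℝ (timeAverage h) (s, v) (0, u) := by
    have := (hasFDerivAt_fst (𝕜 := ℝ) (p := (s, v))).smul (hA (s, v)).hasFDerivAt
    exact (DFunLike.congr_fun this.fderiv _).trans (by simp)
  have h3 : ((a, u) : ℝ × V) = a • (1, 0) + (0, u) := by simp
  rw [h3, map_add, map_smul, h1, h2]

/-- The properties of a Tonelli Lagrangian that enter the global inversion argument. -/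
structure IsConvexSuperlinear (L : V × V → ℝ) : Prop where
  contDiff : ContDiff ℝ 1 L
  convex : ∀ x v v' : V, L (x, v) + fderiv ℝ L (x, v) (0, v' - v) ≤ L (x, v')
  superlinear : ∀ C : ℝ, ∃ R : ℝ, ∀ x v : V, R ≤ ‖v‖ → C * ‖v‖ ≤ L (x, v)
  bounded : ∀ R : ℝ, ∃ M : ℝ, ∀ x v : V, ‖v‖ ≤ R → |L (x, v)| ≤ M

/-- The energy `∂L/∂v · v - L`. -/
def energy (L : V × V → ℝ) (z : V × V) : ℝ := fderiv ℝ L z (0, z.2) - L z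

lemma IsConvexSuperlinear.exists_lt_energy {L : V × V → ℝ} (hL : IsConvexSuperlinear L) (M : ℝ) :
    ∃ R : ℝ, ∀ x v : V, R ≤ ‖v‖ → M < energy L (x, v) := by
  obtain ⟨B, hB⟩ := hL.bounded 1
  obtain ⟨R, hR⟩ := hL.superlinear (M + 2 * B + 1)
  refine ⟨max R 1, fun x v hv => ?_⟩
  have hv1 : 1 ≤ ‖v‖ := (le_max_right _ _).trans hv
  have hv0 : 0 < ‖v‖ := by linarith
  set e := ‖v‖⁻¹ • v
  have he : ‖e‖ ≤ 1 := by rw [norm_smul, norm_inv, norm_norm, inv_mul_cancel₀ hv0.ne']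
  have hve : v = ‖v‖ • e := by rw [smul_smul, mul_inv_cancel₀ hv0.ne', one_smul]
  have h0 := abs_le.1 (hB x 0 (by simp))
  have h1 := abs_le.1 (hB x e he)
  have h2 := hR x v ((le_max_left _ _).trans hv)
  have h3 := hL.convex x v 0
  have h4 := hL.convex x v e
  set p : V →L[ℝ] ℝ := (fderiv ℝ L (x, v)).comp (ContinuousLinearMap.inr ℝ V V) with hp
  have hpa : ∀ u, fderiv ℝ L (x, v) (0, u) = p u := fun u => by simp [hp]
  have hpv : p v = ‖v‖ * p e := by
    conv_lhs => rw [hve]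
    rw [map_smul, smul_eq_mul]
  rw [hpa, map_sub] at h3 h4
  have hen : energy L (x, v) = p v - L (x, v) := by rw [energy, hpa]
  have h5 : (M + 2 * B + 1) * ‖v‖ - B * ‖v‖ ≤ ‖v‖ * p e := by
    have : B ≤ B * ‖v‖ := le_mul_of_one_le_right (by linarith [h0.1, h0.2]) hv1
    rw [map_zero, hpv] at h3
    linarith
  have h6 : M + B + 1 ≤ p e := by
    refine le_of_mul_le_mul_left ?_ hv0
    linarith
  rw [hen]
  linarith

lemma IsConvexSuperlinear.exists_energy_le {L : V × V → ℝ} (hL : IsConvexSuperlinear L) (R : ℝ) :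
    ∃ M : ℝ, ∀ x v : V, ‖v‖ ≤ R → energy L (x, v) ≤ M := by
  obtain ⟨B, hB⟩ := hL.bounded (2 * R)
  refine ⟨3 * B, fun x v hv => ?_⟩
  have hn := norm_nonneg v
  have h1 := abs_le.1 (hB x v (by linarith))
  have h2 := abs_le.1 (hB x (v + v) ((norm_add_le v v).trans (by linarith)))
  have h3 := hL.convex x v (v + v)
  rw [add_sub_cancel_right] at h3
  simp only [energy]
  linarith

/-- `s ↦ P (s, v)`, `v ∈ V`, are the extremals of `L` starting at `x` with velocity `v`, and
`Q` is their velocity. -/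
structure IsExtremalFamily (L : V × V → ℝ) (x : V) (P Q : ℝ × V → V) : Prop where
  contDiff_pos : ContDiff ℝ 1 P
  contDiff_vel : ContDiff ℝ 1 Q
  hasDerivAt_pos : ∀ s v, HasDerivAt (fun s => P (s, v)) (Q (s, v)) s
  pos_zero : ∀ v, P (0, v) = x
  vel_zero : ∀ v, Q (0, v) = v
  euler_lagrange : ∀ s v, HasDerivAt
    (fun s => (fderiv ℝ L (P (s, v), Q (s, v))).comp (ContinuousLinearMap.inr ℝ V V))
    ((fderiv ℝ L (P (s, v), Q (s, v))).comp (ContinuousLinearMap.inl ℝ V V)) s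

namespace IsExtremalFamily

variable {L : V × V → ℝ} {x : V} {P Q : ℝ × V → V}

lemma energy_eq (h : IsExtremalFamily L x P Q) (hL : ContDiff ℝ 1 L) (s : ℝ) (v : V) :
    energy L (P (s, v), Q (s, v)) = energy L (x, v) := by
  have hd : ∀ s, HasDerivAt (fun s => energy L (P (s, v), Q (s, v))) 0 s := by
    intro s
    have hQ : HasDerivAt (fun s => Q (s, v)) (fderiv ℝ Q (s, v) (1, 0)) s :=
      (h.contDiff_vel.differentiable one_ne_zero _).hasFDerivAt.comp_hasDerivAt s
        ((hasDerivAt_id s).prodMk (hasDerivAt_const s v))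
    have h1 := (h.euler_lagrange s v).clm_apply hQ
    have h2 : HasDerivAt (fun s => L (P (s, v), Q (s, v)))
        (fderiv ℝ L (P (s, v), Q (s, v)) (Q (s, v), fderiv ℝ Q (s, v) (1, 0))) s :=
      (hL.differentiable one_ne_zero _).hasFDerivAt.comp_hasDerivAt s
        ((h.hasDerivAt_pos s v).prodMk hQ)
    have h3 := h1.fun_sub h2
    have h4 : ((Q (s, v), fderiv ℝ Q (s, v) (1, 0)) : V × V) =
      (Q (s, v), 0) + (0, fderiv ℝ Q (s, v) (1, 0)) := by simp
    rw [h4, map_add] at h3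
    simpa [energy] using h3
  have := is_const_of_deriv_eq_zero (fun s => (hd s).differentiableAt) (fun s => (hd s).deriv) s 0
  simpa [h.pos_zero, h.vel_zero] using this

lemma exists_le_lagrangian (h : IsExtremalFamily L x P Q) (hL : IsConvexSuperlinear L) (A : ℝ) :
    ∃ R : ℝ, ∀ v : V, R ≤ ‖v‖ → ∀ s, A ≤ L (P (s, v), Q (s, v)) := by
  obtain ⟨R₁, hR₁⟩ := hL.superlinear |A|
  obtain ⟨M, hM⟩ := hL.exists_energy_le (max R₁ 1)
  obtain ⟨R, hR⟩ := hL.exists_lt_energy M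
  refine ⟨R, fun v hv s => ?_⟩
  have h1 : max R₁ 1 ≤ ‖Q (s, v)‖ := by
    by_contra hlt
    have h2 := hM (P (s, v)) (Q (s, v)) (not_le.1 hlt).le
    rw [h.energy_eq hL.contDiff] at h2
    exact (hR x v hv).not_ge h2
  have h3 := hR₁ (P (s, v)) _ ((le_max_left _ _).trans h1)
  have h4 : |A| * 1 ≤ |A| * ‖Q (s, v)‖ :=
    mul_le_mul_of_nonneg_left ((le_max_right _ _).trans h1) (abs_nonneg A)
  linarith [le_abs_self A]

lemma pos_eq [CompleteSpace V] (h : IsExtremalFamily L x P Q) (s : ℝ) (v : V) :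
    P (s, v) = x + s • timeAverage Q (s, v) := by
  have hd : ∀ s, HasDerivAt (fun s => P (s, v) - s • timeAverage Q (s, v)) 0 s := fun s => by
    simpa using (h.hasDerivAt_pos s v).fun_sub
      (hasDerivAt_smul_timeAverage h.contDiff_vel.continuous s v)
  have := is_const_of_deriv_eq_zero (fun s => (hd s).differentiableAt) (fun s => (hd s).deriv) s 0
  simpa [h.pos_zero, sub_eq_iff_eq_add] using this

lemma fderiv_pos_apply [ProperSpace V] [CompleteSpace V] (h : IsExtremalFamily L x P Q)
    (s : ℝ) (v : V) (a : ℝ) (u : V) :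
    fderiv ℝ P (s, v) (a, u) = a • Q (s, v) + s • fderiv ℝ (timeAverage Q) (s, v) (0, u) := by
  have h1 : P = fun p => x + p.1 • timeAverage Q p := funext fun p => h.pos_eq p.1 p.2
  rw [h1, fderiv_const_add, fderiv_smul_timeAverage h.contDiff_vel]

/-- The Lagrangian along the extremals. -/
lemma contDiff_lagrangian (h : IsExtremalFamily L x P Q) (hL : ContDiff ℝ 1 L) :
    ContDiff ℝ 1 fun p => L (P p, Q p) :=
  hL.comp (h.contDiff_pos.prodMk h.contDiff_vel)

/-- First variation formula for the action of the extremals starting at `x`. -/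
lemma fderiv_action [ProperSpace V] [CompleteSpace V] (h : IsExtremalFamily L x P Q)
    (hL : ContDiff ℝ 1 L) (s : ℝ) (v u : V) :
    s • fderiv ℝ (timeAverage fun p => L (P p, Q p)) (s, v) (0, u) =
      fderiv ℝ L (P (s, v), Q (s, v)) (0, fderiv ℝ P (s, v) (0, u)) := by
  have hP : ∀ s, s • fderiv ℝ (timeAverage Q) (s, v) (0, u) = fderiv ℝ P (s, v) (0, u) :=
    fun s => by simp [h.fderiv_pos_apply]
  have hd : ∀ s, HasDerivAt (fun s =>
      s • fderiv ℝ (timeAverage fun p => L (P p, Q p)) (s, v) (0, u) -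
      (fderiv ℝ L (P (s, v), Q (s, v))).comp (ContinuousLinearMap.inr ℝ V V)
        (s • fderiv ℝ (timeAverage Q) (s, v) (0, u))) 0 s := fun s => by
    have h1 := (hasDerivAt_smul_fderiv_timeAverage (h.contDiff_lagrangian hL) s v u).fun_sub
      ((h.euler_lagrange s v).clm_apply
        (hasDerivAt_smul_fderiv_timeAverage h.contDiff_vel s v u))
    have h2 : fderiv ℝ (fun p => L (P p, Q p)) (s, v) (0, u) =
        fderiv ℝ L (P (s, v), Q (s, v)) (fderiv ℝ P (s, v) (0, u), fderiv ℝ Q (s, v) (0, u)) := by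
      have := (hL.differentiable one_ne_zero (P (s, v), Q (s, v))).hasFDerivAt.comp (s, v)
        ((h.contDiff_pos.differentiable one_ne_zero (s, v)).hasFDerivAt.prodMk
          (h.contDiff_vel.differentiable one_ne_zero (s, v)).hasFDerivAt)
      exact DFunLike.congr_fun this.fderiv _
    have h3 : ((fderiv ℝ P (s, v) (0, u), fderiv ℝ Q (s, v) (0, u)) : V × V) =
      (fderiv ℝ P (s, v) (0, u), 0) + (0, fderiv ℝ Q (s, v) (0, u)) := by simp
    rw [h2, h3, map_add] at h1
    refine h1.congr_deriv ?_
    simp [-map_smul, hP]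
  have := is_const_of_deriv_eq_zero (fun s => (hd s).differentiableAt) (fun s => (hd s).deriv) s 0
  simp only [zero_smul, map_zero, sub_zero, sub_eq_zero] at this
  rw [this, hP]
  simp

lemma exists_hasStrictFDerivAt [FiniteDimensional ℝ V] (h : IsExtremalFamily L x P Q)
    (hnd : ∀ s v u, s ≠ 0 → fderiv ℝ P (s, v) (0, u) = 0 → u = 0) (q : ℝ × V) :
    ∃ D : (ℝ × V) ≃L[ℝ] (ℝ × V),
      HasStrictFDerivAt (fun p : ℝ × V => (p.1, timeAverage Q p)) (D : ℝ × V →L[ℝ] ℝ × V) q := by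
  have : ProperSpace V := FiniteDimensional.proper ℝ V
  have : CompleteSpace V := FiniteDimensional.complete ℝ V
  obtain ⟨s, v⟩ := q
  have hG := contDiff_timeAverage h.contDiff_vel
  have hstrict : HasStrictFDerivAt (fun p : ℝ × V => (p.1, timeAverage Q p))
      ((ContinuousLinearMap.fst ℝ ℝ V).prod (fderiv ℝ (timeAverage Q) (s, v))) (s, v) :=
    hasStrictFDerivAt_fst.prodMk (hG.contDiffAt.hasStrictFDerivAt one_ne_zero)
  have hinr : ∀ u, fderiv ℝ (timeAverage Q) (s, v) (0, u) = 0 → u = 0 := by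
    intro u hu
    by_cases hs : s = 0
    · subst hs
      have h1 : HasFDerivAt (fun v => timeAverage Q (0, v)) _ v :=
        (hG.differentiable one_ne_zero (0, v)).hasFDerivAt.comp v (hasFDerivAt_prodMk_right 0 v)
      have h2 : (fun v => timeAverage Q (0, v)) = id := by
        funext v
        simp [timeAverage, h.vel_zero]
      rw [h2] at h1
      have := DFunLike.congr_fun (h1.unique (hasFDerivAt_id v)) u
      simpa [hu] using this.symm
    · refine hnd s v u hs ?_
      rw [h.fderiv_pos_apply, hu]
      simp
  have hinj : Function.Injective
      ((ContinuousLinearMap.fst ℝ ℝ V).prod (fderiv ℝ (timeAverage Q) (s, v))) := by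
    refine (injective_iff_map_eq_zero _).2 ?_
    rintro ⟨a, u⟩ hau
    simp only [ContinuousLinearMap.prod_apply, ContinuousLinearMap.coe_fst', Prod.mk_eq_zero] at hau
    obtain ⟨rfl, hu⟩ := hau
    rw [hinr u hu]
    rfl
  refine ⟨(LinearEquiv.ofInjectiveEndo _ hinj).toContinuousLinearEquiv, ?_⟩
  exact hstrict

lemma isLocalHomeomorph [FiniteDimensional ℝ V] (h : IsExtremalFamily L x P Q)
    (hnd : ∀ s v u, s ≠ 0 → fderiv ℝ P (s, v) (0, u) = 0 → u = 0) :
    IsLocalHomeomorph fun p : ℝ × V => (p.1, timeAverage Q p) := by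
  have : CompleteSpace V := FiniteDimensional.complete ℝ V
  intro q
  obtain ⟨D, hD⟩ := h.exists_hasStrictFDerivAt hnd q
  exact ⟨hD.toOpenPartialHomeomorph _, hD.mem_toOpenPartialHomeomorph_source, rfl⟩

/-- Weierstrass comparison: along a lift of the straight line `s ↦ x + s w`, the action of the
extremals grows at most as fast as that of the line. -/
lemma exists_hasDerivAt_action_le [FiniteDimensional ℝ V] (h : IsExtremalFamily L x P Q)
    (hL : IsConvexSuperlinear L)
    (hnd : ∀ s v u, s ≠ 0 → fderiv ℝ P (s, v) (0, u) = 0 → u = 0) {z : ℝ → V} {w : V} {s : ℝ}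
    (hz : ContinuousAt z s) (hzw : ∀ᶠ r in 𝓝 s, timeAverage Q (r, z r) = w) :
    ∃ c ≤ L (x + s • w, w),
      HasDerivAt (fun r => r • timeAverage (fun p => L (P p, Q p)) (r, z r)) c s := by
  have : ProperSpace V := FiniteDimensional.proper ℝ V
  have : CompleteSpace V := FiniteDimensional.complete ℝ V
  obtain ⟨D, hD⟩ := h.exists_hasStrictFDerivAt hnd (s, z s)
  have hzs : DifferentiableAt ℝ z s := by
    have h1 : ∀ᶠ r in 𝓝 s, hD.localInverse _ _ _ (r, timeAverage Q (r, z r)) = (r, z r) :=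
      (continuousAt_id.prodMk hz).eventually hD.eventually_left_inverse
    have h2 : (fun r => (hD.localInverse _ _ _ (r, w)).2) =ᶠ[𝓝 s] z := by
      filter_upwards [h1, hzw] with r hr hrw
      rw [hrw] at hr
      rw [hr]
    have h3 : DifferentiableAt ℝ (hD.localInverse _ _ _) (s, w) := by
      have := hD.to_localInverse.hasFDerivAt.differentiableAt
      rwa [hzw.self_of_nhds] at this
    have h4 : DifferentiableAt ℝ (fun r : ℝ => (r, w)) s := by fun_prop
    exact ((differentiableAt_snd.comp s (h3.comp s h4)).congr_of_eventuallyEq h2.symm)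
  have hz' : HasDerivAt (fun r => (r, z r)) (1, deriv z s) s :=
    (hasDerivAt_id s).prodMk hzs.hasDerivAt
  have hPs : P (s, z s) = x + s • w := by rw [h.pos_eq, hzw.self_of_nhds]
  have hline : fderiv ℝ P (s, z s) (1, deriv z s) = w := by
    have h1 : HasDerivAt (fun r => P (r, z r)) _ s :=
      (h.contDiff_pos.differentiable one_ne_zero (s, z s)).hasFDerivAt.comp_hasDerivAt s hz'
    have h2 : (fun r => P (r, z r)) =ᶠ[𝓝 s] fun r => x + r • w := by
      filter_upwards [hzw] with r hr
      rw [h.pos_eq, hr]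
    have h3 : HasDerivAt (fun r : ℝ => x + r • w) w s := by
      simpa using ((hasDerivAt_id s).smul_const w).const_add x
    exact h1.unique (h3.congr_of_eventuallyEq h2)
  have hvert : fderiv ℝ P (s, z s) (0, deriv z s) = w - Q (s, z s) := by
    rw [h.fderiv_pos_apply] at hline ⊢
    rw [← hline]
    simp
  have hCL := h.contDiff_lagrangian hL.contDiff
  have hS : DifferentiableAt ℝ
      (fun p : ℝ × V => p.1 • timeAverage (fun p => L (P p, Q p)) p) (s, z s) := by
    have := (contDiff_timeAverage hCL).differentiable one_ne_zero
    fun_prop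
  have hder := HasFDerivAt.comp_hasDerivAt
    (l := fun p : ℝ × V => p.1 • timeAverage (fun p => L (P p, Q p)) p) s hS.hasFDerivAt hz'
  refine ⟨_, ?_, hder⟩
  rw [fderiv_smul_timeAverage hCL, h.fderiv_action hL.contDiff, hvert, one_smul, ← hPs]
  exact hL.convex _ _ _

/-- A lift of the straight line `s ↦ x + s w` is a priori bounded. -/
lemma exists_norm_lift_le [FiniteDimensional ℝ V] (h : IsExtremalFamily L x P Q)
    (hL : IsConvexSuperlinear L)
    (hnd : ∀ s v u, s ≠ 0 → fderiv ℝ P (s, v) (0, u) = 0 → u = 0) (w : V) :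
    ∃ R : ℝ, ∀ τ, 0 ≤ τ → ∀ z : ℝ → V, ContinuousOn z (Icc 0 τ) → z 0 = w →
      (∀ s ∈ Icc 0 τ, timeAverage Q (s, z s) = w) → ‖z τ‖ ≤ R := by
  have : ProperSpace V := FiniteDimensional.proper ℝ V
  have : CompleteSpace V := FiniteDimensional.complete ℝ V
  obtain ⟨K, hK⟩ := hL.bounded ‖w‖
  obtain ⟨R, hR⟩ := h.exists_le_lagrangian hL (K + 1)
  refine ⟨max R ‖w‖, fun τ hτ z hz hz0 hzw => ?_⟩
  rcases hτ.eq_or_lt with rfl | hτ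
  · rw [hz0]
    exact le_max_right _ _
  by_contra! hlt
  have hCL := h.contDiff_lagrangian hL.contDiff
  have hder : ∀ s ∈ Ioo 0 τ, ∃ c ≤ L (x + s • w, w),
      HasDerivAt (fun r => r • timeAverage (fun p => L (P p, Q p)) (r, z r)) c s := fun s hs =>
    h.exists_hasDerivAt_action_le hL hnd (hz.continuousAt (Icc_mem_nhds hs.1 hs.2))
      (by filter_upwards [Icc_mem_nhds hs.1 hs.2] with r hr using hzw r hr)
  have hupper : τ • timeAverage (fun p => L (P p, Q p)) (τ, z τ) ≤ K * τ := by
    have := (convex_Icc 0 τ).image_sub_le_mul_sub_of_deriv_le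
      (f := fun r => r • timeAverage (fun p => L (P p, Q p)) (r, z r)) (C := K) ?_ ?_ ?_
      0 (left_mem_Icc.2 hτ.le) τ (right_mem_Icc.2 hτ.le) hτ.le
    · simpa using this
    · exact continuousOn_id.smul ((contDiff_timeAverage hCL).continuous.comp_continuousOn
        (continuousOn_id.prodMk hz))
    · rw [interior_Icc]
      intro s hs
      obtain ⟨c, -, hc⟩ := hder s hs
      exact hc.differentiableAt.differentiableWithinAt
    · rw [interior_Icc]
      intro s hs
      obtain ⟨c, hcL, hc⟩ := hder s hs
      rw [hc.deriv]
      exact hcL.trans (abs_le.1 (hK _ w le_rfl)).2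
  have hlower : K + 1 ≤ timeAverage (fun p => L (P p, Q p)) (τ, z τ) := by
    have hc : Continuous fun p => L (P p, Q p) := hCL.continuous
    have := intervalIntegral.integral_mono_on (μ := volume) (a := 0) (b := 1)
      (f := fun _ => K + 1) (g := fun r => L (P (τ * r, z τ), Q (τ * r, z τ))) zero_le_one
      intervalIntegrable_const (Continuous.intervalIntegrable
        (hc.comp (by fun_prop : Continuous fun r : ℝ => (τ * r, z τ))) _ _)
      fun r _ => hR (z τ) ((le_max_left _ _).trans hlt.le) (τ * r)
    simpa [timeAverage] using this
  have := mul_le_mul_of_nonneg_left hlower hτ.le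
  rw [smul_eq_mul] at hupper
  linarith

/-- Without conjugate points, the extremals starting at `x` have distinct endpoints. -/
theorem injective_pos [FiniteDimensional ℝ V] (h : IsExtremalFamily L x P Q)
    (hL : IsConvexSuperlinear L)
    (hnd : ∀ s v u, s ≠ 0 → fderiv ℝ P (s, v) (0, u) = 0 → u = 0) {t : ℝ} (ht : 0 < t) :
    Function.Injective fun v => P (t, v) := by
  have : ProperSpace V := FiniteDimensional.proper ℝ V
  have : CompleteSpace V := FiniteDimensional.complete ℝ V
  have hG := (contDiff_timeAverage h.contDiff_vel).continuous
  have hloc := h.isLocalHomeomorph hnd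
  have hid : ∀ v, timeAverage Q (0, v) = v := fun v => by simp [timeAverage, h.vel_zero]
  have hinj := injective_of_exists_lift hG hloc hid ht.le fun w => by
    obtain ⟨R, hR⟩ := h.exists_norm_lift_le hL hnd w
    exact exists_lift_of_bounded hG hloc (hid w) ht.le fun τ hτ => hR τ hτ.1
  intro v v' hvv'
  refine hinj ?_
  simpa [h.pos_eq, ht.ne'] using hvv'

end IsExtremalFamily

namespace IsTonelliLagrangian

variable {n : ℕ} {k : ℕ∞} {L : E n × E n → ℝ}

lemma fderiv_inr (hL : IsTonelliLagrangian n k L) (hk : 2 ≤ k) (x v : E n) :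
    (fderiv ℝ L (x, v)).comp (ContinuousLinearMap.inr ℝ (E n) (E n)) = partialV n L x v := by
  have hd : Differentiable ℝ L := hL.smooth.differentiable
    (by exact_mod_cast (two_pos.trans_le hk).ne')
  exact (((hd (x, v)).hasFDerivAt.comp v (hasFDerivAt_prodMk_right x v)).fderiv).symm

lemma fderiv_inl (hL : IsTonelliLagrangian n k L) (hk : 2 ≤ k) (x v : E n) :
    (fderiv ℝ L (x, v)).comp (ContinuousLinearMap.inl ℝ (E n) (E n)) = partialX n L x v := by
  have hd : Differentiable ℝ L := hL.smooth.differentiable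
    (by exact_mod_cast (two_pos.trans_le hk).ne')
  exact ((hd (x, v)).hasFDerivAt.comp x (hasFDerivAt_prodMk_left x v)).fderiv.symm

lemma add_partialV_le (hL : IsTonelliLagrangian n k L) (hk : 2 ≤ k) (x v v' : E n) :
    L (x, v) + partialV n L x v (v' - v) ≤ L (x, v') := by
  set d := v' - v
  have hf : ContDiff ℝ 2 fun u => L (x, u) :=
    (hL.smooth.of_le (WithTop.coe_le_coe.2 hk)).comp (contDiff_prodMk_right x)
  have hf' : ContDiff ℝ 1 (fderiv ℝ fun u => L (x, u)) := hf.fderiv_right (by norm_num)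
  have hline : ∀ r : ℝ, HasDerivAt (fun r : ℝ => v + r • d) d r := fun r => by
    simpa using ((hasDerivAt_id r).smul_const d).const_add v
  have h1 : ∀ r : ℝ, HasDerivAt (fun r : ℝ => L (x, v + r • d)) (partialV n L x (v + r • d) d) r :=
    fun r => HasFDerivAt.comp_hasDerivAt (l := fun u => L (x, u)) r
      (hf.differentiable two_ne_zero (v + r • d)).hasFDerivAt (hline r)
  have h2 : ∀ r : ℝ, HasDerivAt (fun r : ℝ => partialV n L x (v + r • d) d)
      (fderiv ℝ (fun u => fderiv ℝ (fun u' => L (x, u')) u d) (v + r • d) d) r := fun r => by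
    have : Differentiable ℝ fun u => fderiv ℝ (fun u' => L (x, u')) u d := fun u =>
      (hf'.differentiable one_ne_zero u).clm_apply (differentiableAt_const d)
    exact (this (v + r • d)).hasFDerivAt.comp_hasDerivAt r (hline r)
  have hmono : Monotone fun r : ℝ => partialV n L x (v + r • d) d := by
    refine monotone_of_deriv_nonneg (fun r => (h2 r).differentiableAt) fun r => ?_
    rw [(h2 r).deriv]
    by_cases h0 : d = 0
    · simp [h0]
    · exact (hL.posdef x _ d h0).le
  obtain ⟨c, hc, hceq⟩ := exists_hasDerivAt_eq_slope _ _ (zero_lt_one' ℝ)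
    (fun r _ => (h1 r).continuousAt.continuousWithinAt) fun r _ => h1 r
  have h3 := hmono hc.1.le
  simp only [hceq, zero_smul, add_zero, one_smul, sub_zero, div_one] at h3
  have h4 : v + d = v' := add_sub_cancel v v'
  rw [h4] at h3
  linarith

lemma bounded (hL : IsTonelliLagrangian n k L) (R : ℝ) :
    ∃ M : ℝ, ∀ x v : E n, ‖v‖ ≤ R → |L (x, v)| ≤ M := by
  obtain ⟨M, hM⟩ := ((isCompact_Icc (a := (0 : E n)) (b := 1)).prod
    (isCompact_closedBall (0 : E n) R)).exists_bound_of_continuousOn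
      hL.smooth.continuous.continuousOn
  refine ⟨M, fun x v hv => ?_⟩
  have hx : x = (fun i => Int.fract (x i)) + intVec fun i => ⌊x i⌋ := by
    funext i
    simp [intVec]
  rw [hx, hL.periodic]
  exact hM (_, v) ⟨⟨fun i => Int.fract_nonneg _, fun i => (Int.fract_lt_one _).le⟩,
    mem_closedBall_zero_iff.2 hv⟩

lemma isConvexSuperlinear (hL : IsTonelliLagrangian n k L) (hk : 2 ≤ k) :
    IsConvexSuperlinear L where
  contDiff := hL.smooth.of_le (by exact_mod_cast one_le_two.trans hk)
  convex x v v' := by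
    have := hL.add_partialV_le hk x v v'
    rwa [← hL.fderiv_inr hk] at this
  superlinear := hL.superlinear
  bounded := hL.bounded

end IsTonelliLagrangian

lemma IsELFlow.isExtremalFamily {n k : ℕ} {L : E n × E n → ℝ}
    {φ : ℝ → E n × E n → E n × E n} (hφ : IsELFlow n k L φ)
    (hL : IsTonelliLagrangian n (k : ℕ∞) L) (hk : 2 ≤ k) (x : E n) :
    IsExtremalFamily L x (fun p => (φ p.1 (x, p.2)).1) (fun p => (φ p.1 (x, p.2)).2) := by
  obtain ⟨hsm, h0, hel⟩ := hφ
  have hC : ContDiff ℝ 1 fun p : ℝ × E n => φ p.1 (x, p.2) :=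
    (hsm.of_le (m := 1) (by exact_mod_cast Nat.le_sub_of_add_le hk)).comp
      (contDiff_fst.prodMk (contDiff_const.prodMk contDiff_snd) :
        ContDiff ℝ 1 fun p : ℝ × E n => (p.1, (x, p.2)))
  refine ⟨contDiff_fst.comp hC, contDiff_snd.comp hC, fun s v => ?_, fun v => by simp [h0],
    fun v => by simp [h0], fun s v => ?_⟩
  · simp only [(hel x v).2 s]
    exact ((hel x v).1.1.differentiable two_ne_zero s).hasDerivAt
  · have := (hel x v).1.2 s
    simp only [← (hel x v).2] at this
    simpa only [hL.fderiv_inr (by exact_mod_cast hk), hL.fderiv_inl (by exact_mod_cast hk)]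
      using this

end GlobalInversion

/-- For a Tonelli Lagrangian without conjugate points, for every `t > 0`
and `x ∈ ℝⁿ`, the "exponential" map `v ↦ π (φ_t (x, v))` is injective. -/
theorem exp_map_injective (n k : ℕ) (hn : 1 ≤ n) (hk : 2 ≤ k)
    (L : E n × E n → ℝ) (hL : IsTonelliLagrangian n (k : ℕ∞) L)
    (φ : ℝ → E n × E n → E n × E n) (hφ : IsELFlow n k L φ)
    (hnc : NoConjugatePoints n φ) :
    ∀ t : ℝ, 0 < t → ∀ x : E n,
      Function.Injective (fun v : E n => (φ t (x, v)).1) := by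
  intro t ht x
  refine (hφ.isExtremalFamily hL hk x).injective_pos
    (hL.isConvexSuperlinear (by exact_mod_cast hk)) (fun s v u hs hu => ?_) ht
  refine hnc (x, v) s hs u ?_
  have hd : Differentiable ℝ fun p : ℝ × (E n × E n) => φ p.1 p.2 :=
    hφ.1.differentiable (by exact_mod_cast (Nat.sub_pos_of_lt hk).ne')
  have hin : Differentiable ℝ fun p : ℝ × E n => φ p.1 (x, p.2) :=
    hd.comp (by fun_prop : Differentiable ℝ fun p : ℝ × E n => (p.1, (x, p.2)))
  have hφs : DifferentiableAt ℝ (φ s) (x, v) :=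
    (hd (s, (x, v))).comp (x, v) (by fun_prop : DifferentiableAt ℝ (Prod.mk s) (x, v))
  have h1 : HasFDerivAt (fun v' => (φ s (x, v')).1) _ v :=
    (hφs.hasFDerivAt.comp v (hasFDerivAt_prodMk_right x v)).fst
  have h2 : HasFDerivAt (fun v' => (φ s (x, v')).1) _ v :=
    (hin.fst (s, v)).hasFDerivAt.comp v (hasFDerivAt_prodMk_right s v)
  simpa using (DFunLike.congr_fun (h1.unique h2) u).trans hu

end
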